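/- Let ρ : ℕ → ℕ satisfy ρ(n)/log n → ∞ as n → ∞ (i.e., ρ(n) = ω(log n)) and ρ(n) ≤ n/4 for all n. Let a ≥ 1 be a constant, let m : ℕ → ℕ satisfy m(n) ≤ n^a for all n, and for each n let A_n be a learning algorithm mapping labeled m(n)-samples over {0,1}^n to hypotheses h : {0,1}^n → {0,1}. Then there exist n ∈ ℕ and a monotone conjunction c over {0,1}^n such that, for S drawn i.i.d. from the uniform distribution D on {0,1}^n, E_{S∼D^{m(n)}}[R^E_{ρ(n)}(A_n(S_c), c)] > 0.1. In particular, the class of monotone conjunctions is not ρ-robustly learnable with polynomial sample complexity under the uniform distribution when ρ(n) = ω(log n). -/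

import Mathlib

open MeasureTheory ENNReal Filter

/-- Exact-in-the-ball robust risk `R^E_ρ(h,c)` on the Boolean hypercube. -/
noncomputable def RE (N ρ : ℕ) (μ : Measure (Fin N → Bool))
    (h c : (Fin N → Bool) → Bool) : ℝ≥0∞ :=
  μ {x | ∃ z : Fin N → Bool, hammingDist x z ≤ ρ ∧ h z ≠ c z}

/-- Constant-in-the-ball robust risk `R^C_ρ(h,c)` on the Boolean hypercube. -/
noncomputable def RC (N ρ : ℕ) (μ : Measure (Fin N → Bool))
    (h c : (Fin N → Bool) → Bool) : ℝ≥0∞ :=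
  μ {x | ∃ z : Fin N → Bool, hammingDist x z ≤ ρ ∧ h z ≠ c x}

/-- Label a sample `S` with target concept `c`. -/
def labelWith (n : ℕ) (c : (Fin n → Bool) → Bool) {m : ℕ}
    (S : Fin m → (Fin n → Bool)) : Fin m → (Fin n → Bool) × Bool :=
  fun i => (S i, c (S i))

/-- Expected exact-in-the-ball robust risk of learner `A` on an i.i.d. `m`-sample. -/
noncomputable def expRisk (n m ρ : ℕ) (μ : Measure (Fin n → Bool))
    (A : (Fin m → (Fin n → Bool) × Bool) → ((Fin n → Bool) → Bool))
    (c : (Fin n → Bool) → Bool) : ℝ≥0∞ :=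
  ∫⁻ S, RE n ρ μ (A (labelWith n c S)) c ∂(Measure.pi fun _ : Fin m => μ)

/-- Monotone conjunction with index set `I`. -/
def monConj (n : ℕ) (I : Finset (Fin n)) : (Fin n → Bool) → Bool :=
  fun x => decide (∀ i ∈ I, x i = true)

/-- Uniform distribution on the Boolean hypercube. -/
noncomputable def unif (n : ℕ) : Measure (Fin n → Bool) :=
  (PMF.uniformOfFintype (Fin n → Bool)).toMeasure

/-- `μ` is `α`-log-Lipschitz: every point has positive mass and the log of the
mass function is `log α`-Lipschitz w.r.t. Hamming distance. -/
def logLipschitz (n : ℕ) (α : ℝ) (μ : Measure (Fin n → Bool)) : Prop :=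
  (∀ x : Fin n → Bool, 0 < μ {x}) ∧
  ∀ x x' : Fin n → Bool, hammingDist x x' = 1 →
    |Real.log (μ {x}).toReal - Real.log (μ {x'}).toReal| ≤ Real.log α

instance unif.instIsProbabilityMeasure (n : ℕ) : IsProbabilityMeasure (unif n) := by
  unfold unif; infer_instance

lemma unif_map_equiv_preimage (n : ℕ) (e : (Fin n → Bool) ≃ (Fin n → Bool))
    (s : Set (Fin n → Bool)) : unif n (e ⁻¹' s) = unif n s := by
  classical
  unfold unif
  rw [PMF.toMeasure_uniformOfFintype_apply _ (Set.toFinite _).measurableSet,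
    PMF.toMeasure_uniformOfFintype_apply _ (Set.toFinite _).measurableSet]
  congr 2
  exact Fintype.card_congr (e.subtypeEquiv fun _ => Iff.rfl)

lemma unif_monConj_eq_true (n : ℕ) (I : Finset (Fin n)) :
    unif n {x | monConj n I x = true} = (2⁻¹ : ℝ≥0∞) ^ I.card := by
  classical
  unfold unif
  rw [PMF.toMeasure_uniformOfFintype_apply _ (Set.toFinite _).measurableSet]
  have hcard : Fintype.card {x : Fin n → Bool | monConj n I x = true} = 2 ^ (n - I.card) := by
    have hpi : {x : Fin n → Bool | monConj n I x = true} =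
        ↑(Fintype.piFinset fun i => if i ∈ I then ({true} : Finset Bool) else Finset.univ) := by
      ext x
      simp only [monConj, Set.mem_ofPred_eq, decide_eq_true_eq, Finset.mem_coe,
        Fintype.mem_piFinset]
      refine forall_congr' fun i => ?_
      split_ifs with h <;> simp [h]
    have hprod : ∏ i : Fin n, (if i ∈ I then ({true} : Finset Bool) else Finset.univ).card =
        2 ^ (n - I.card) := by
      have : ∀ i : Fin n, (if i ∈ I then ({true} : Finset Bool) else Finset.univ).card =
          if i ∈ I then 1 else 2 := fun i => by split_ifs <;> simp
      simp only [this, Finset.prod_ite, Finset.prod_const, one_pow, one_mul]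
      congr 1
      rw [← Finset.compl_filter, Finset.card_compl, Fintype.card_fin]
      simp
    rw [← hprod, ← Fintype.card_piFinset, ← Set.toFinset_card, Set.toFinset_congr hpi]
    simp only [Finset.toFinset_coe]
  rw [hcard]
  have hI : I.card ≤ n := by simpa using I.card_le_univ
  simp only [Fintype.card_fun, Fintype.card_bool, Fintype.card_fin, Nat.cast_pow, Nat.cast_ofNat]
  rw [← ENNReal.inv_pow]
  refine ((ENNReal.eq_div_iff (by simp) (by simp)).2 ?_).symm
  nth_rewrite 1 [← Nat.sub_add_cancel hI]
  rw [pow_add, mul_assoc, ENNReal.mul_inv_cancel (by simp) (by simp), mul_one]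

/-- With probability at least `1/2`, at most half of the coordinates in `I` are false. -/
lemma half_le_unif_card_false_le (n k : ℕ) (I : Finset (Fin n)) (hI : I.card ≤ 2 * k) :
    (2⁻¹ : ℝ≥0∞) ≤ unif n {x | (I.filter fun i => x i = false).card ≤ k} := by
  set E : Set (Fin n → Bool) := {x | (I.filter fun i => x i = false).card ≤ k} with hE
  let e : (Fin n → Bool) ≃ (Fin n → Bool) := Equiv.piCongrRight fun _ => Equiv.boolNot
  have hcover : E ∪ e ⁻¹' E = Set.univ := by
    refine Set.eq_univ_of_forall fun x => ?_
    have hsum := Finset.card_filter_add_card_filter_not (s := I) (fun i => x i = false)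
    have hflip : (I.filter fun i => e x i = false) = I.filter fun i => ¬ x i = false := by
      refine Finset.filter_congr fun i _ => ?_
      simp [e]
    simp only [hE, Set.mem_union, Set.mem_preimage, Set.mem_ofPred_eq, hflip]
    omega
  have h := measure_union_le (μ := unif n) E (e ⁻¹' E)
  rw [hcover, measure_univ, unif_map_equiv_preimage, ← two_mul] at h
  rwa [ENNReal.inv_le_iff_le_mul (by simp) (by simp)]

lemma exists_hammingDist_le_monConj_ne {n k : ℕ} {I J : Finset (Fin n)} (hIJ : Disjoint I J)
    {x : Fin n → Bool} (hI : (I.filter fun i => x i = false).card ≤ k)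
    (hJ : monConj n J x ≠ true) :
    ∃ z, hammingDist x z ≤ k ∧ monConj n I z ≠ monConj n J z := by
  classical
  refine ⟨fun i => if i ∈ I then true else x i, ?_, ?_⟩
  · refine le_trans (Finset.card_le_card fun i hi => ?_) hI
    by_cases h : i ∈ I <;> simp_all
  · have h1 : monConj n I (fun i => if i ∈ I then true else x i) = true := by
      simp +contextual [monConj]
    rw [h1]
    refine fun h2 => hJ ?_
    simp only [monConj, true_eq_decide_iff, decide_eq_true_eq] at h2 ⊢
    intro i hi
    simpa [Finset.disjoint_right.1 hIJ hi] using h2 i hi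

/-- Two disjoint conjunctions on `2 * k` variables disagree in the `k`-ball around a random point
with probability at least about `1/2`. -/
lemma half_le_RE_monConj_add {n k : ℕ} {I J : Finset (Fin n)} (hIJ : Disjoint I J)
    (hI : I.card ≤ 2 * k) :
    (2⁻¹ : ℝ≥0∞) ≤ RE n k (unif n) (monConj n I) (monConj n J) + 2⁻¹ ^ J.card := by
  refine (half_le_unif_card_false_le n k I hI).trans ?_
  rw [← unif_monConj_eq_true n J]
  refine (measure_mono fun x hx => ?_).trans (measure_union_le _ _)
  by_cases hJ : monConj n J x = true
  · exact Or.inr hJ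
  · exact Or.inl (exists_hammingDist_le_monConj_ne hIJ hx hJ)

lemma RE_le_add (n k : ℕ) (μ : Measure (Fin n → Bool)) (h c c' : (Fin n → Bool) → Bool) :
    RE n k μ c c' ≤ RE n k μ h c + RE n k μ h c' := by
  refine (measure_mono ?_).trans (measure_union_le _ _)
  rintro x ⟨z, hz, hne⟩
  by_cases hc : h z = c z
  · exact Or.inr ⟨z, hz, hc ▸ hne⟩
  · exact Or.inl ⟨z, hz, hc⟩

/-- If all sample points are labelled negatively by both targets, the learner cannot tell the
targets apart. -/
lemma RE_mul_measure_le_expRisk_add (n m k : ℕ) (μ : Measure (Fin n → Bool))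
    (A : (Fin m → (Fin n → Bool) × Bool) → ((Fin n → Bool) → Bool))
    (c c' : (Fin n → Bool) → Bool) :
    RE n k μ c c' * Measure.pi (fun _ : Fin m => μ) {S | ∀ i, c (S i) = c' (S i)} ≤
      expRisk n m k μ A c + expRisk n m k μ A c' := by
  unfold expRisk
  rw [← lintegral_add_left (measurable_of_finite _), ← setLIntegral_const]
  refine (setLIntegral_mono_ae (measurable_of_finite _).aemeasurable
    (ae_of_all _ fun S hS => ?_)).trans (setLIntegral_le_lintegral _ _)
  have hlabel : labelWith n c S = labelWith n c' S := by
    funext i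
    simp only [labelWith, Prod.mk.injEq, true_and]
    exact hS i
  rw [hlabel]
  exact RE_le_add n k μ _ c c'

lemma one_le_measure_pi_forall_add {α : Type*} [MeasurableSpace α] (m : ℕ) (μ : Measure α)
    [IsProbabilityMeasure μ] {s : Set α} (hs : MeasurableSet s) :
    1 ≤ Measure.pi (fun _ : Fin m => μ) {S | ∀ i, S i ∈ s} + m * μ sᶜ := by
  have hcover : (Set.univ : Set (Fin m → α)) ⊆
      {S | ∀ i, S i ∈ s} ∪ ⋃ i : Fin m, Function.eval i ⁻¹' sᶜ := by
    intro S _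
    by_cases h : ∀ i, S i ∈ s
    · exact Or.inl h
    · push Not at h
      exact Or.inr (Set.mem_iUnion.2 h)
  have hone : Measure.pi (fun _ : Fin m => μ) Set.univ = 1 := measure_univ
  rw [← hone]
  refine (measure_mono hcover).trans ((measure_union_le _ _).trans ?_)
  gcongr
  refine (measure_iUnion_le _).trans ?_
  rw [tsum_fintype]
  have hcoord : ∀ i : Fin m, Measure.pi (fun _ : Fin m => μ) (Function.eval i ⁻¹' sᶜ) = μ sᶜ :=
    fun i => (measurePreserving_eval (fun _ : Fin m => μ) i).measure_preimage
      hs.compl.nullMeasurableSet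
  simp only [hcoord, Finset.sum_const, Finset.card_univ, Fintype.card_fin, nsmul_eq_mul, le_refl]

lemma one_le_measure_pi_monConj_eq_add (n m : ℕ) (I J : Finset (Fin n)) :
    1 ≤ Measure.pi (fun _ : Fin m => unif n) {S | ∀ i, monConj n I (S i) = monConj n J (S i)} +
      m * (2⁻¹ ^ I.card + 2⁻¹ ^ J.card) := by
  refine (one_le_measure_pi_forall_add m (unif n)
    (s := {x | monConj n I x = monConj n J x}) (Set.toFinite _).measurableSet).trans ?_
  rw [← unif_monConj_eq_true n I, ← unif_monConj_eq_true n J]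
  simp only [Set.mem_ofPred_eq]
  gcongr
  refine (measure_mono fun x hx => ?_).trans (measure_union_le _ _)
  have hne : monConj n I x ≠ monConj n J x := hx
  simp only [Set.mem_union, Set.mem_ofPred_eq]
  cases hI : monConj n I x <;> cases hJ : monConj n J x <;> simp_all

lemma exists_quarter_pow_le (ρ m : ℕ → ℕ) (a : ℝ) (ha : 1 ≤ a)
    (hρ : Tendsto (fun n : ℕ => (ρ n : ℝ) / Real.log n) atTop atTop)
    (hm : ∀ n, (m n : ℝ) ≤ (n : ℝ) ^ a) :
    ∃ n, (1 / 4 : ℝ) ^ ρ n ≤ 1 / 100 ∧ (m n : ℝ) * (1 / 4 : ℝ) ^ ρ n ≤ 1 / 100 := by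
  obtain ⟨n, hK, hn⟩ := ((hρ.eventually_ge_atTop (a + 1)).and (eventually_ge_atTop 100)).exists
  have hn' : (100 : ℝ) ≤ n := by exact_mod_cast hn
  have hn0 : (0 : ℝ) < n := by linarith
  have hlog : 0 < Real.log n := Real.log_pos (by linarith)
  have hK' : (a + 1) * Real.log n ≤ ρ n := (le_div_iff₀ hlog).1 hK
  have hquarter : (1 / 4 : ℝ) ≤ Real.exp (-1) := by
    rw [Real.exp_neg, one_div]
    exact inv_anti₀ (Real.exp_pos _) (by linarith [Real.exp_one_lt_d9])
  have hpow : (1 / 4 : ℝ) ^ ρ n ≤ (n : ℝ) ^ (-(a + 1)) := calc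
    (1 / 4 : ℝ) ^ ρ n ≤ Real.exp (-1) ^ ρ n := by gcongr
    _ = Real.exp (-ρ n) := by rw [← Real.exp_nat_mul]; simp
    _ ≤ Real.exp (Real.log n * (-(a + 1))) := Real.exp_le_exp.2 (by linarith)
    _ = (n : ℝ) ^ (-(a + 1)) := (Real.rpow_def_of_pos hn0 _).symm
  have hinv : (n : ℝ) ^ (-1 : ℝ) ≤ 1 / 100 := by
    rw [Real.rpow_neg_one, one_div]
    exact inv_anti₀ (by norm_num) hn'
  refine ⟨n, hpow.trans (le_trans ?_ hinv), ?_⟩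
  · exact Real.rpow_le_rpow_of_exponent_le (by linarith) (by linarith)
  · calc (m n : ℝ) * (1 / 4 : ℝ) ^ ρ n ≤ (n : ℝ) ^ a * (n : ℝ) ^ (-(a + 1)) := by
          gcongr
          exact hm n
      _ = (n : ℝ) ^ (-1 : ℝ) := by rw [← Real.rpow_add hn0]; congr 1; ring
      _ ≤ 1 / 100 := hinv

lemma exists_disjoint_card_eq {n k : ℕ} (h : 2 * k ≤ n) :
    ∃ I J : Finset (Fin n), Disjoint I J ∧ I.card = k ∧ J.card = k := by
  obtain ⟨I, -, hI⟩ := Finset.exists_subset_card_eq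
    (s := (Finset.univ : Finset (Fin n))) (n := k) (by simp; omega)
  obtain ⟨J, hJI, hJ⟩ := Finset.exists_subset_card_eq (s := Iᶜ) (n := k)
    (by rw [Finset.card_compl, Fintype.card_fin]; omega)
  exact ⟨I, J, disjoint_compl_right.mono_right hJI, hI, hJ⟩

/-- if `ρ(n) = ω(log n)`, `ρ(n) ≤ n/4`, and the sample size is
polynomially bounded, then for every family of learners there exist a dimension
`n` and a monotone conjunction target whose expected robust risk exceeds `0.1`
under the uniform distribution: monotone conjunctions are not `ρ`-robustly
learnable with polynomial sample complexity. -/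
theorem stmt8 (ρ m : ℕ → ℕ) (a : ℝ) (ha : 1 ≤ a)
    (hρ : Tendsto (fun n : ℕ => (ρ n : ℝ) / Real.log n) atTop atTop)
    (hρn : ∀ n, 4 * ρ n ≤ n)
    (hm : ∀ n, (m n : ℝ) ≤ (n : ℝ) ^ a)
    (A : ∀ n : ℕ, (Fin (m n) → (Fin n → Bool) × Bool) → ((Fin n → Bool) → Bool)) :
    ∃ (n : ℕ) (I : Finset (Fin n)),
      expRisk n (m n) (ρ n) (unif n) (A n) (monConj n I) > 1 / 10 := by
  obtain ⟨n, hq, hmq⟩ := exists_quarter_pow_le ρ m a ha hρ hm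
  obtain ⟨I, J, hIJ, hI, hJ⟩ := exists_disjoint_card_eq (n := n) (k := 2 * ρ n)
    (by linarith [hρn n])
  by_contra! hle
  have hrisk := (RE_mul_measure_le_expRisk_add n (m n) (ρ n) (unif n) (A n) (monConj n I)
    (monConj n J)).trans (add_le_add (hle n I) (hle n J))
  have hball := half_le_RE_monConj_add (k := ρ n) hIJ hI.le
  have hsample := one_le_measure_pi_monConj_eq_add n (m n) I J
  have hR : RE n (ρ n) (unif n) (monConj n I) (monConj n J) ≠ ∞ := measure_ne_top _ _
  generalize RE n (ρ n) (unif n) (monConj n I) (monConj n J) = R at hrisk hball hR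
  have hP : Measure.pi (fun _ : Fin (m n) => unif n)
      {S | ∀ i, monConj n I (S i) = monConj n J (S i)} ≠ ∞ := measure_ne_top _ _
  generalize Measure.pi (fun _ : Fin (m n) => unif n)
      {S | ∀ i, monConj n I (S i) = monConj n J (S i)} = P at hrisk hsample hP
  lift R to NNReal using hR
  lift P to NNReal using hP
  rw [hI, hJ] at *
  have hcoe : (2⁻¹ : ℝ≥0∞) = ((2⁻¹ : NNReal) : ℝ≥0∞) := by simp
  have htenth : (1 / 10 : ℝ≥0∞) = ((1 / 10 : NNReal) : ℝ≥0∞) := by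
    rw [ENNReal.coe_div (by norm_num)]; simp
  rw [hcoe] at hball hsample
  rw [htenth] at hrisk
  have hball' : (2⁻¹ : ℝ) ≤ R + 2⁻¹ ^ (2 * ρ n) := by exact_mod_cast hball
  have hsample' : (1 : ℝ) ≤ P + m n * (2⁻¹ ^ (2 * ρ n) + 2⁻¹ ^ (2 * ρ n)) := by
    exact_mod_cast hsample
  have hrisk' : (R : ℝ) * P ≤ 1 / 10 + 1 / 10 := by exact_mod_cast hrisk
  have hpow : (2⁻¹ : ℝ) ^ (2 * ρ n) = (1 / 4) ^ ρ n := by rw [pow_mul]; norm_num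
  rw [hpow] at hball' hsample'
  have hR' : (49 / 100 : ℝ) ≤ R := by linarith
  have hP' : (98 / 100 : ℝ) ≤ P := by linarith
  nlinarith
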